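/- arXiv:2012.11836 — 9 statements merged into one kernel-verified Lean document; each statement's English description precedes it below -/
import Mathlib

section
/- The D-optimal joint BLUP coefficient vector a satisfies the two unbiasedness conditions aᵀ𝟏 = 1 and aᵀα = α_s. -/
open Matrix

/-- The D-optimal joint BLUP coefficient vector `a` satisfies the two unbiasedness
conditions `aᵀ𝟏 = 1` and `aᵀα = α_s`. -/
theorem d_optimal_blup_a_unbiased
    {r : ℕ} (hr : 0 < r)
    (Sig : Matrix (Fin r) (Fin r) ℝ) (hSig : Sig.PosDef)
    (one : Fin r → ℝ) (hone : one = fun _ => (1 : ℝ))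
    (α : Fin r → ℝ) (αs αt : ℝ) (hst : αs ≠ αt)
    (ip : (Fin r → ℝ) → (Fin r → ℝ) → ℝ)
    (hip : ∀ x y, ip x y = x ⬝ᵥ (Sig⁻¹ *ᵥ y))
    (Δ : ℝ) (hΔ : Δ = ip one one * ip α α - (ip one α) ^ 2) (hΔ0 : Δ ≠ 0)
    (αS αT : Fin r → ℝ) (hαS : αS = α - αs • one) (hαT : αT = α - αt • one)
    (a : Fin r → ℝ)
    (ha : a = ((αt - αs) * Δ)⁻¹ •
      (ip αS αT • (Sig⁻¹ *ᵥ αS) - ip αS αS • (Sig⁻¹ *ᵥ αT))) :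
    a ⬝ᵥ one = 1 ∧ a ⬝ᵥ α = αs := by
  have hsymm : ∀ x y : Fin r → ℝ, x ⬝ᵥ (Sig⁻¹ *ᵥ y) = y ⬝ᵥ (Sig⁻¹ *ᵥ x) := by
    intro x y
    have hT : (Sig⁻¹)ᵀ = Sig⁻¹ := by
      simpa [IsHermitian, conjTranspose_eq_transpose_of_trivial] using hSig.isHermitian.inv
    rw [dotProduct_mulVec, ← mulVec_transpose, hT, dotProduct_comm]
  have hd : αt - αs ≠ 0 := sub_ne_zero.mpr hst.symm
  have hpair : ∀ x, a ⬝ᵥ x =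
      ((αt - αs) * Δ)⁻¹ * (ip αS αT * ip αS x - ip αS αS * ip αT x) := by
    intro x
    rw [ha, hip αS x, hip αT x, hsymm αS x, hsymm αT x]
    simp only [dotProduct_comm _ x, dotProduct_smul, dotProduct_sub, smul_eq_mul]
  have hcomm : ip α one = ip one α := by rw [hip, hip, hsymm]
  have hS : ∀ x, ip αS x = ip α x - αs * ip one x := by
    intro x
    simp only [hip, hαS, sub_dotProduct, smul_dotProduct, smul_eq_mul]
  have hT : ∀ x, ip αT x = ip α x - αt * ip one x := by
    intro x
    simp only [hip, hαT, sub_dotProduct, smul_dotProduct, smul_eq_mul]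
  have hS' : ∀ x, ip x αS = ip x α - αs * ip x one := by
    intro x
    simp only [hip, hαS, mulVec_sub, mulVec_smul, dotProduct_sub, dotProduct_smul, smul_eq_mul]
  have hT' : ∀ x, ip x αT = ip x α - αt * ip x one := by
    intro x
    simp only [hip, hαT, mulVec_sub, mulVec_smul, dotProduct_sub, dotProduct_smul, smul_eq_mul]
  constructor <;>
  · rw [hpair, inv_mul_eq_iff_eq_mul₀ (mul_ne_zero hd hΔ0)]
    simp only [hS, hT, hS', hT', hcomm, hΔ]
    ring
end

section
/- The D-optimal joint BLUP coefficient vector b satisfies the two unbiasedness conditions bᵀ𝟏 = 1 and bᵀα = α_t. -/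
open Matrix

/-- The D-optimal joint BLUP coefficient vector `b` satisfies the two unbiasedness
conditions `bᵀ𝟏 = 1` and `bᵀα = α_t`. -/
theorem d_optimal_blup_b_unbiased
    {r : ℕ} (hr : 0 < r)
    (Sig : Matrix (Fin r) (Fin r) ℝ) (hSig : Sig.PosDef)
    (one : Fin r → ℝ) (hone : one = fun _ => (1 : ℝ))
    (α : Fin r → ℝ) (αs αt : ℝ) (hst : αs ≠ αt)
    (ip : (Fin r → ℝ) → (Fin r → ℝ) → ℝ)
    (hip : ∀ x y, ip x y = x ⬝ᵥ (Sig⁻¹ *ᵥ y))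
    (Δ : ℝ) (hΔ : Δ = ip one one * ip α α - (ip one α) ^ 2) (hΔ0 : Δ ≠ 0)
    (αS αT : Fin r → ℝ) (hαS : αS = α - αs • one) (hαT : αT = α - αt • one)
    (b : Fin r → ℝ)
    (hb : b = ((αt - αs) * Δ)⁻¹ •
      (ip αT αT • (Sig⁻¹ *ᵥ αS) - ip αT αS • (Sig⁻¹ *ᵥ αT))) :
    b ⬝ᵥ one = 1 ∧ b ⬝ᵥ α = αt := by
  have hsymm : ∀ x y : Fin r → ℝ, x ⬝ᵥ (Sig⁻¹ *ᵥ y) = y ⬝ᵥ (Sig⁻¹ *ᵥ x) := by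
    intro x y
    have hT : (Sig⁻¹)ᵀ = Sig⁻¹ := by
      simpa [IsHermitian, conjTranspose_eq_transpose_of_trivial] using hSig.isHermitian.inv
    rw [dotProduct_mulVec, ← mulVec_transpose, hT, dotProduct_comm]
  have hts : αt - αs ≠ 0 := sub_ne_zero.mpr hst.symm
  have hb_dot : ∀ x, b ⬝ᵥ x =
      ((αt - αs) * Δ)⁻¹ * (ip αT αT * ip x αS - ip αT αS * ip x αT) := by
    intro x
    rw [hb, dotProduct_comm, hip x αS, hip x αT]
    simp only [dotProduct_smul, dotProduct_sub, smul_eq_mul]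
  have hD := mul_ne_zero hts hΔ0
  constructor <;>
  · rw [hb_dot, inv_mul_eq_iff_eq_mul₀ hD, hΔ]
    simp only [hip, hαS, hαT, mulVec_sub, mulVec_smul, dotProduct_sub, sub_dotProduct,
      dotProduct_smul, smul_dotProduct, smul_eq_mul, hsymm α one]
    ring
end

section
/- The variance–covariance entries of the D-optimal joint BLUPs satisfy aᵀΣa = ⟨α_(s),α_(s)⟩/Δ, aᵀΣb = ⟨α_(t),α_(s)⟩/Δ, and bᵀΣb = ⟨α_(t),α_(t)⟩/Δ. -/
open Matrix

/-- The bilinear form of a symmetric matrix is symmetric. -/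
theorem Matrix.IsSymm.dotProduct_mulVec_comm {n R : Type*} [Fintype n] [CommSemiring R]
    {M : Matrix n n R} (hM : M.IsSymm) (x y : n → R) : x ⬝ᵥ (M *ᵥ y) = y ⬝ᵥ (M *ᵥ x) := by
  rw [dotProduct_mulVec, dotProduct_comm, ← mulVec_transpose, hM.eq]

/-- Gram determinant of two translates of `x` along `e`. -/
theorem Matrix.IsSymm.gram_det_sub_smul {n R : Type*} [Fintype n] [CommRing R]
    {M : Matrix n n R} (hM : M.IsSymm) (e x : n → R) (c d : R) :
    ((x - c • e) ⬝ᵥ (M *ᵥ (x - c • e))) * ((x - d • e) ⬝ᵥ (M *ᵥ (x - d • e)))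
        - ((x - c • e) ⬝ᵥ (M *ᵥ (x - d • e))) ^ 2
      = (d - c) ^ 2 * ((e ⬝ᵥ (M *ᵥ e)) * (x ⬝ᵥ (M *ᵥ x)) - (e ⬝ᵥ (M *ᵥ x)) ^ 2) := by
  simp only [mulVec_sub, mulVec_smul, sub_dotProduct, dotProduct_sub, smul_dotProduct,
    dotProduct_smul, smul_eq_mul, hM.dotProduct_mulVec_comm x e]
  ring

/-- The form of `M` on combinations of vectors in the image of `M⁻¹`, in terms of the form
of `M⁻¹`. -/
theorem Matrix.IsSymm.dotProduct_mulVec_inv_combination {n R : Type*} [Fintype n] [DecidableEq n]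
    [CommRing R] {M : Matrix n n R} (hM : M⁻¹.IsSymm) (hdet : IsUnit M.det)
    (x y : n → R) (k p q p' q' : R) :
    (k • (p • (M⁻¹ *ᵥ x) - q • (M⁻¹ *ᵥ y))) ⬝ᵥ
        (M *ᵥ (k • (p' • (M⁻¹ *ᵥ x) - q' • (M⁻¹ *ᵥ y))))
      = k ^ 2 * (p * p' * (x ⬝ᵥ (M⁻¹ *ᵥ x)) - (p * q' + q * p') * (x ⬝ᵥ (M⁻¹ *ᵥ y))
        + q * q' * (y ⬝ᵥ (M⁻¹ *ᵥ y))) := by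
  have hinv (v : n → R) : M *ᵥ (M⁻¹ *ᵥ v) = v := by
    rw [mulVec_mulVec, mul_nonsing_inv _ hdet, one_mulVec]
  simp only [mulVec_sub, mulVec_smul, hinv, sub_dotProduct, dotProduct_sub, smul_dotProduct,
    dotProduct_smul, smul_eq_mul, dotProduct_comm (M⁻¹ *ᵥ _), hM.dotProduct_mulVec_comm y x]
  ring

/-- Corollary 1: the variance–covariance entries of the D-optimal joint BLUPs satisfy
`aᵀΣa = ⟨α_(s),α_(s)⟩/Δ`, `aᵀΣb = ⟨α_(t),α_(s)⟩/Δ`, and `bᵀΣb = ⟨α_(t),α_(t)⟩/Δ`. -/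
theorem d_optimal_blup_variance_covariance
    {r : ℕ} (hr : 0 < r)
    (Sig : Matrix (Fin r) (Fin r) ℝ) (hSig : Sig.PosDef)
    (one : Fin r → ℝ) (hone : one = fun _ => (1 : ℝ))
    (α : Fin r → ℝ) (αs αt : ℝ) (hst : αs ≠ αt)
    (ip : (Fin r → ℝ) → (Fin r → ℝ) → ℝ)
    (hip : ∀ x y, ip x y = x ⬝ᵥ (Sig⁻¹ *ᵥ y))
    (Δ : ℝ) (hΔ : Δ = ip one one * ip α α - (ip one α) ^ 2) (hΔ0 : Δ ≠ 0)
    (αS αT : Fin r → ℝ) (hαS : αS = α - αs • one) (hαT : αT = α - αt • one)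
    (a b : Fin r → ℝ)
    (ha : a = ((αt - αs) * Δ)⁻¹ •
      (ip αS αT • (Sig⁻¹ *ᵥ αS) - ip αS αS • (Sig⁻¹ *ᵥ αT)))
    (hb : b = ((αt - αs) * Δ)⁻¹ •
      (ip αT αT • (Sig⁻¹ *ᵥ αS) - ip αT αS • (Sig⁻¹ *ᵥ αT))) :
    a ⬝ᵥ (Sig *ᵥ a) = ip αS αS / Δ ∧
    a ⬝ᵥ (Sig *ᵥ b) = ip αT αS / Δ ∧
    b ⬝ᵥ (Sig *ᵥ b) = ip αT αT / Δ := by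
  have hsymm : Sig⁻¹.IsSymm := by
    simpa [IsHermitian, IsSymm, conjTranspose_eq_transpose_of_trivial] using hSig.isHermitian.inv
  have hdet : IsUnit Sig.det := hSig.det_pos.ne'.isUnit
  have hgram : ip αS αS * ip αT αT - ip αS αT ^ 2 = (αt - αs) ^ 2 * Δ := by
    simp only [hΔ, hip, hαS, hαT]
    exact hsymm.gram_det_sub_smul one α αs αt
  have hcomm : ip αT αS = ip αS αT := by
    simp only [hip, hsymm.dotProduct_mulVec_comm αT αS]
  have hne : αt - αs ≠ 0 := sub_ne_zero.mpr hst.symm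
  have hform (p q p' q' : ℝ) :=
    hsymm.dotProduct_mulVec_inv_combination hdet αS αT ((αt - αs) * Δ)⁻¹ p q p' q'
  simp only [← hip αS αS, ← hip αS αT, ← hip αT αT] at hform
  have hscale : (((αt - αs) * Δ)⁻¹) ^ 2 * (ip αS αS * ip αT αT - ip αS αT ^ 2) = Δ⁻¹ := by
    rw [hgram]
    field_simp
  rw [ha, hb, hform, hform, hform, hcomm]
  simp only [div_eq_mul_inv, ← hscale]
  refine ⟨?_, ?_, ?_⟩ <;> ring
end

section
/- The determinant of the variance–covariance matrix of the D-optimal joint BLUPs satisfies (aᵀΣa)(bᵀΣb) − (aᵀΣb)² = (⟨α_(s),α_(s)⟩·⟨α_(t),α_(t)⟩ − ⟨α_(s),α_(t)⟩²)/Δ². -/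
open Matrix

theorem dotProduct_mulVec_of_inv_mulVec {n : Type*} [Fintype n] [DecidableEq n]
    {A : Matrix n n ℝ} (hA : IsUnit A.det) (hsymm : Aᵀ = A) (x y : n → ℝ) :
    (A⁻¹ *ᵥ x) ⬝ᵥ (A *ᵥ (A⁻¹ *ᵥ y)) = x ⬝ᵥ (A⁻¹ *ᵥ y) := by
  rw [mulVec_mulVec, mul_nonsing_inv A hA, one_mulVec, dotProduct_mulVec, ← mulVec_transpose,
    transpose_nonsing_inv, hsymm]

/-- The determinant of the variance–covariance matrix of the D-optimal joint BLUPs: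
`(aᵀΣa)(bᵀΣb) − (aᵀΣb)² = (⟨α_(s),α_(s)⟩·⟨α_(t),α_(t)⟩ − ⟨α_(s),α_(t)⟩²)/Δ²`. -/
theorem d_optimal_blup_determinant
    {r : ℕ} (hr : 0 < r)
    (Sig : Matrix (Fin r) (Fin r) ℝ) (hSig : Sig.PosDef)
    (one : Fin r → ℝ) (hone : one = fun _ => (1 : ℝ))
    (α : Fin r → ℝ) (αs αt : ℝ) (hst : αs ≠ αt)
    (ip : (Fin r → ℝ) → (Fin r → ℝ) → ℝ)
    (hip : ∀ x y, ip x y = x ⬝ᵥ (Sig⁻¹ *ᵥ y))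
    (Δ : ℝ) (hΔ : Δ = ip one one * ip α α - (ip one α) ^ 2) (hΔ0 : Δ ≠ 0)
    (αS αT : Fin r → ℝ) (hαS : αS = α - αs • one) (hαT : αT = α - αt • one)
    (a b : Fin r → ℝ)
    (ha : a = ((αt - αs) * Δ)⁻¹ •
      (ip αS αT • (Sig⁻¹ *ᵥ αS) - ip αS αS • (Sig⁻¹ *ᵥ αT)))
    (hb : b = ((αt - αs) * Δ)⁻¹ •
      (ip αT αT • (Sig⁻¹ *ᵥ αS) - ip αT αS • (Sig⁻¹ *ᵥ αT))) :
    (a ⬝ᵥ (Sig *ᵥ a)) * (b ⬝ᵥ (Sig *ᵥ b)) - (a ⬝ᵥ (Sig *ᵥ b)) ^ 2 =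
      (ip αS αS * ip αT αT - (ip αS αT) ^ 2) / Δ ^ 2 := by
  have hdet : IsUnit Sig.det := hSig.det_pos.ne'.isUnit
  have hsymm : Sigᵀ = Sig := by
    simpa [conjTranspose_eq_transpose_of_trivial] using hSig.isHermitian.eq
  have hip_comm (x y) : ip x y = ip y x := by
    rw [hip, hip, dotProduct_mulVec, ← mulVec_transpose, transpose_nonsing_inv, hsymm,
      dotProduct_comm]
  have hcov (x y) : (Sig⁻¹ *ᵥ x) ⬝ᵥ (Sig *ᵥ (Sig⁻¹ *ᵥ y)) = ip x y := by
    rw [hip, dotProduct_mulVec_of_inv_mulVec hdet hsymm]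
  have hip_sub (u v : ℝ) : ip (α - u • one) (α - v • one) =
      ip α α - (u + v) * ip one α + u * v * ip one one := by
    have h := hip_comm one α
    simp only [hip, mulVec_sub, mulVec_smul, dotProduct_sub, sub_dotProduct, dotProduct_smul,
      smul_dotProduct, smul_eq_mul] at h ⊢
    linear_combination v * h
  have hgram : ip αS αS * ip αT αT - ip αS αT ^ 2 = (αt - αs) ^ 2 * Δ := by
    rw [hαS, hαT, hip_sub, hip_sub, hip_sub, hΔ]
    ring
  have hd : αt - αs ≠ 0 := sub_ne_zero.mpr hst.symm
  have hcoef (k p q p' q' : ℝ) :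
      (k • (p • (Sig⁻¹ *ᵥ αS) - q • (Sig⁻¹ *ᵥ αT))) ⬝ᵥ
        (Sig *ᵥ (k • (p' • (Sig⁻¹ *ᵥ αS) - q' • (Sig⁻¹ *ᵥ αT)))) =
      k ^ 2 * (p * p' * ip αS αS - (p * q' + q * p') * ip αS αT + q * q' * ip αT αT) := by
    simp only [mulVec_sub, mulVec_smul, dotProduct_sub, sub_dotProduct, dotProduct_smul,
      smul_dotProduct, smul_eq_mul, hcov, hip_comm αT αS]
    ring
  rw [ha, hb, hcoef, hcoef, hcoef, hip_comm αT αS]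
  have hk : ((αt - αs) * Δ)⁻¹ ^ 4 * (ip αS αS * ip αT αT - ip αS αT ^ 2) ^ 2 = (Δ ^ 2)⁻¹ := by
    rw [hgram]
    field_simp
  rw [div_eq_mul_inv, ← hk]
  ring
end

section
/- (D-optimality of the joint BLUPs, Theorem 1.) For every pair of vectors c, d ∈ ℝ^r satisfying the unbiasedness constraints cᵀ𝟏 = 1, cᵀα = α_s, dᵀ𝟏 = 1 and dᵀα = α_t, the determinant of the variance–covariance matrix of the linear predictors cᵀX and dᵀX dominates that of the D-optimal joint BLUPs: (cᵀΣc)(dᵀΣd) − (cᵀΣd)² ≥ (aᵀΣa)(bᵀΣb) − (aᵀΣb)². -/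
open Matrix

/-- The determinant of a sum of two positive semidefinite `2 × 2` matrices dominates
the determinant of the first one. -/
theorem det_two_le_det_two_add {p q u p' q' u' : ℝ}
    (hp : 0 ≤ p) (hu : 0 ≤ u) (hq : q ^ 2 ≤ p * u)
    (hp' : 0 ≤ p') (hu' : 0 ≤ u') (hq' : q' ^ 2 ≤ p' * u') :
    p * u - q ^ 2 ≤ (p + p') * (u + u') - (q + q') ^ 2 := by
  have h : (2 * (q * q')) ^ 2 ≤ (p * u' + u * p') ^ 2 := by
    have := mul_le_mul hq hq' (sq_nonneg q') (mul_nonneg hp hu)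
    nlinarith [sq_nonneg (p * u' - u * p')]
  have := abs_le_of_sq_le_sq' h (by positivity)
  nlinarith [this.2]

theorem Matrix.PosSemidef.sq_dotProduct_mulVec_le {n : Type*} [Fintype n]
    {M : Matrix n n ℝ} (hM : M.PosSemidef) (x y : n → ℝ) :
    (x ⬝ᵥ (M *ᵥ y)) ^ 2 ≤ (x ⬝ᵥ (M *ᵥ x)) * (y ⬝ᵥ (M *ᵥ y)) := by
  have hsymm : M.IsSymm := by simpa [IsHermitian, IsSymm] using hM.isHermitian
  have h : ∀ t : ℝ, 0 ≤ (x ⬝ᵥ (M *ᵥ x)) * (t * t) + 2 * (x ⬝ᵥ (M *ᵥ y)) * t +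
      y ⬝ᵥ (M *ᵥ y) := by
    intro t
    have := hM.dotProduct_mulVec_nonneg (t • x + y)
    simp only [star_trivial, mulVec_add, mulVec_smul, dotProduct_add, add_dotProduct,
      dotProduct_smul, smul_dotProduct, smul_eq_mul, hsymm.dotProduct_mulVec_comm y x] at this
    linarith
  have := discrim_le_zero h
  rw [discrim] at this
  linarith

/-- D-optimality of the joint BLUPs (Theorem 1): for every pair of coefficient vectors
`c, d` satisfying the unbiasedness constraints `cᵀ𝟏 = 1`, `cᵀα = α_s`, `dᵀ𝟏 = 1`,
`dᵀα = α_t`, the determinant of the variance–covariance matrix of the corresponding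
linear predictors dominates that of the D-optimal joint BLUPs. -/
theorem d_optimal_blup_optimality
    {r : ℕ} (hr : 0 < r)
    (Sig : Matrix (Fin r) (Fin r) ℝ) (hSig : Sig.PosDef)
    (one : Fin r → ℝ) (hone : one = fun _ => (1 : ℝ))
    (α : Fin r → ℝ) (αs αt : ℝ) (hst : αs ≠ αt)
    (ip : (Fin r → ℝ) → (Fin r → ℝ) → ℝ)
    (hip : ∀ x y, ip x y = x ⬝ᵥ (Sig⁻¹ *ᵥ y))
    (Δ : ℝ) (hΔ : Δ = ip one one * ip α α - (ip one α) ^ 2) (hΔ0 : Δ ≠ 0)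
    (αS αT : Fin r → ℝ) (hαS : αS = α - αs • one) (hαT : αT = α - αt • one)
    (a b : Fin r → ℝ)
    (ha : a = ((αt - αs) * Δ)⁻¹ •
      (ip αS αT • (Sig⁻¹ *ᵥ αS) - ip αS αS • (Sig⁻¹ *ᵥ αT)))
    (hb : b = ((αt - αs) * Δ)⁻¹ •
      (ip αT αT • (Sig⁻¹ *ᵥ αS) - ip αT αS • (Sig⁻¹ *ᵥ αT))) :
    ∀ c d : Fin r → ℝ,
      c ⬝ᵥ one = 1 → c ⬝ᵥ α = αs → d ⬝ᵥ one = 1 → d ⬝ᵥ α = αt →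
      (c ⬝ᵥ (Sig *ᵥ c)) * (d ⬝ᵥ (Sig *ᵥ d)) - (c ⬝ᵥ (Sig *ᵥ d)) ^ 2 ≥
        (a ⬝ᵥ (Sig *ᵥ a)) * (b ⬝ᵥ (Sig *ᵥ b)) - (a ⬝ᵥ (Sig *ᵥ b)) ^ 2 := by
  intro c d hc1 hcα hd1 hdα
  have hsymm : Sig.IsSymm := by simpa [IsHermitian, IsSymm] using hSig.isHermitian
  have hisymm : (Sig⁻¹).IsSymm := by
    simpa [IsHermitian, IsSymm] using hSig.inv.isHermitian
  have hcancel : ∀ v, Sig *ᵥ (Sig⁻¹ *ᵥ v) = v := fun v => by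
    rw [mulVec_mulVec, mul_nonsing_inv _ ((isUnit_iff_isUnit_det _).1 hSig.isUnit), one_mulVec]
  have hts : αt - αs ≠ 0 := sub_ne_zero.2 hst.symm
  have hcomm : ∀ x y, ip x y = ip y x := fun x y => by
    rw [hip, hip, hisymm.dotProduct_mulVec_comm]
  have hdot : ∀ x y, (Sig⁻¹ *ᵥ x) ⬝ᵥ y = ip y x := fun x y => by rw [hip, dotProduct_comm]
  have hgram : ip αS αS * ip αT αT - ip αS αT ^ 2 = (αt - αs) ^ 2 * Δ := by
    have h := hcomm one α
    simp only [hip] at h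
    rw [hΔ, hαS, hαT]
    simp only [hip, mulVec_sub, mulVec_smul, dotProduct_sub, sub_dotProduct, dotProduct_smul,
      smul_dotProduct, smul_eq_mul, h]
    ring
  have haS : a ⬝ᵥ αS = 0 := by
    simp only [ha, smul_dotProduct, sub_dotProduct, hdot, smul_eq_mul]
    ring
  have haT : a ⬝ᵥ αT = αs - αt := by
    simp only [ha, smul_dotProduct, sub_dotProduct, hdot, smul_eq_mul, hcomm αT αS]
    field_simp
    linear_combination -hgram
  have hbS : b ⬝ᵥ αS = αt - αs := by
    simp only [hb, smul_dotProduct, sub_dotProduct, hdot, smul_eq_mul, hcomm αT αS]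
    field_simp
    linear_combination hgram
  have hbT : b ⬝ᵥ αT = 0 := by
    simp only [hb, smul_dotProduct, sub_dotProduct, hdot, smul_eq_mul, hcomm αT αS]
    ring
  obtain ⟨e, rfl⟩ : ∃ e, c = a + e := ⟨c - a, by abel⟩
  obtain ⟨f, rfl⟩ : ∃ f, d = b + f := ⟨d - b, by abel⟩
  have heS : e ⬝ᵥ αS = 0 := by
    have h : (a + e) ⬝ᵥ αS = 0 := by simp [hαS, dotProduct_sub, hc1, hcα]
    rwa [add_dotProduct, haS, zero_add] at h
  have heT : e ⬝ᵥ αT = 0 := by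
    have h : (a + e) ⬝ᵥ αT = αs - αt := by simp [hαT, dotProduct_sub, hc1, hcα]
    rw [add_dotProduct, haT] at h
    linarith
  have hfS : f ⬝ᵥ αS = 0 := by
    have h : (b + f) ⬝ᵥ αS = αt - αs := by simp [hαS, dotProduct_sub, hd1, hdα]
    rw [add_dotProduct, hbS] at h
    linarith
  have hfT : f ⬝ᵥ αT = 0 := by
    have h : (b + f) ⬝ᵥ αT = 0 := by simp [hαT, dotProduct_sub, hd1, hdα]
    rwa [add_dotProduct, hbT, zero_add] at h
  have horth : ∀ v, v ⬝ᵥ αS = 0 → v ⬝ᵥ αT = 0 →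
      v ⬝ᵥ (Sig *ᵥ a) = 0 ∧ v ⬝ᵥ (Sig *ᵥ b) = 0 := by
    intro v hS hT
    constructor <;>
      simp [ha, hb, mulVec_smul, mulVec_sub, hcancel, dotProduct_sub, hS, hT]
  obtain ⟨hea, heb⟩ := horth e heS heT
  obtain ⟨hfa, hfb⟩ := horth f hfS hfT
  have hnonneg : ∀ v, 0 ≤ v ⬝ᵥ (Sig *ᵥ v) := fun v => by
    simpa using hSig.posSemidef.dotProduct_mulVec_nonneg v
  simp only [mulVec_add, dotProduct_add, add_dotProduct, hea, heb, hfb,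
    hsymm.dotProduct_mulVec_comm a e, hsymm.dotProduct_mulVec_comm a f,
    hsymm.dotProduct_mulVec_comm b f, hfa, add_zero, zero_add]
  exact det_two_le_det_two_add (hnonneg a) (hnonneg b)
    (hSig.posSemidef.sq_dotProduct_mulVec_le a b) (hnonneg e) (hnonneg f)
    (hSig.posSemidef.sq_dotProduct_mulVec_le e f)
end

section
/- Suppose there exist real numbers λ₁, λ₁*, λ₂, λ₂* such that (bᵀΣb)·Σa − (aᵀΣb)·Σb = λ₁𝟏 + λ₁*α and (aᵀΣa)·Σb − (aᵀΣb)·Σa = λ₂𝟏 + λ₂*α. Then, writing V₁₁ := aᵀΣa, V₁₂ := aᵀΣb, V₂₂ := bᵀΣb and |V| := V₁₁V₂₂ − V₁₂², the vector identities V₂₂·a − V₁₂·b = (|V|/(α_s − α_t))·Σ⁻¹(α − α_t𝟏) and V₁₁·b − V₁₂·a = (|V|/(α_t − α_s))·Σ⁻¹(α − α_s𝟏) hold. -/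
open Matrix

/-- If `S (c • p - d • q)` lies in the span of `u` and `w`, with `p ⬝ᵥ u = q ⬝ᵥ u = 1`, and it is
orthogonal to `q`, then it is a multiple of `w - (q ⬝ᵥ w) • u`, the factor being determined by its
product with `p`. -/
theorem sub_smul_eq_smul_inv_mulVec {n : Type*} [Fintype n] [DecidableEq n]
    {S : Matrix n n ℝ} (hS : IsUnit S.det) {u w p q : n → ℝ} {s t c d l m v : ℝ} (hst : s ≠ t)
    (hpu : p ⬝ᵥ u = 1) (hpw : p ⬝ᵥ w = s) (hqu : q ⬝ᵥ u = 1) (hqw : q ⬝ᵥ w = t)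
    (hL : c • (S *ᵥ p) - d • (S *ᵥ q) = l • u + m • w)
    (hp : c * (p ⬝ᵥ (S *ᵥ p)) - d * (p ⬝ᵥ (S *ᵥ q)) = v)
    (hq : c * (q ⬝ᵥ (S *ᵥ p)) - d * (q ⬝ᵥ (S *ᵥ q)) = 0) :
    c • p - d • q = (v / (s - t)) • (S⁻¹ *ᵥ (w - t • u)) := by
  have hLp := congrArg (p ⬝ᵥ ·) hL
  have hLq := congrArg (q ⬝ᵥ ·) hL
  simp only [dotProduct_sub, dotProduct_add, dotProduct_smul, smul_eq_mul, hp, hq, hpu, hpw, hqu,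
    hqw] at hLp hLq
  have hm : v / (s - t) = m := by
    rw [div_eq_iff (sub_ne_zero.mpr hst)]
    linarith
  have hl : l = -(m * t) := by linarith
  have hvec : S *ᵥ (c • p - d • q) = m • (w - t • u) := by
    rw [mulVec_sub, mulVec_smul, mulVec_smul, hL, hl]
    module
  rw [hm, ← mulVec_smul, ← hvec, mulVec_mulVec, nonsing_inv_mul S hS, one_mulVec]

/-- Equations (E11) and (E12): if the Lagrange stationarity conditions hold for some
multipliers, then `V₂₂·a − V₁₂·b = (|V|/(α_s − α_t))·Σ⁻¹(α − α_t𝟏)` and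
`V₁₁·b − V₁₂·a = (|V|/(α_t − α_s))·Σ⁻¹(α − α_s𝟏)`. -/
theorem d_optimal_blup_stationarity_vector_identities
    {r : ℕ} (hr : 0 < r)
    (Sig : Matrix (Fin r) (Fin r) ℝ) (hSig : Sig.PosDef)
    (one : Fin r → ℝ) (hone : one = fun _ => (1 : ℝ))
    (α : Fin r → ℝ) (αs αt : ℝ) (hst : αs ≠ αt)
    (a b : Fin r → ℝ)
    (ha1 : a ⬝ᵥ one = 1) (haα : a ⬝ᵥ α = αs)
    (hb1 : b ⬝ᵥ one = 1) (hbα : b ⬝ᵥ α = αt)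
    (l1 l1s l2 l2s : ℝ)
    (hL1 : (b ⬝ᵥ (Sig *ᵥ b)) • (Sig *ᵥ a) - (a ⬝ᵥ (Sig *ᵥ b)) • (Sig *ᵥ b) =
      l1 • one + l1s • α)
    (hL2 : (a ⬝ᵥ (Sig *ᵥ a)) • (Sig *ᵥ b) - (a ⬝ᵥ (Sig *ᵥ b)) • (Sig *ᵥ a) =
      l2 • one + l2s • α)
    (V11 V12 V22 V : ℝ)
    (hV11 : V11 = a ⬝ᵥ (Sig *ᵥ a)) (hV12 : V12 = a ⬝ᵥ (Sig *ᵥ b))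
    (hV22 : V22 = b ⬝ᵥ (Sig *ᵥ b)) (hV : V = V11 * V22 - V12 ^ 2) :
    V22 • a - V12 • b = (V / (αs - αt)) • (Sig⁻¹ *ᵥ (α - αt • one)) ∧
    V11 • b - V12 • a = (V / (αt - αs)) • (Sig⁻¹ *ᵥ (α - αs • one)) := by
  have hdet : IsUnit Sig.det := hSig.det_pos.ne'.isUnit
  have hsymm : b ⬝ᵥ (Sig *ᵥ a) = a ⬝ᵥ (Sig *ᵥ b) := by
    have hT : Sigᵀ = Sig := by simpa using hSig.isHermitian.eq
    rw [dotProduct_mulVec, ← mulVec_transpose, hT, dotProduct_comm]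
  subst hV11 hV12 hV22 hV
  constructor
  · refine sub_smul_eq_smul_inv_mulVec hdet hst ha1 haα hb1 hbα hL1 ?_ ?_
    · ring
    · rw [hsymm]
      ring
  · refine sub_smul_eq_smul_inv_mulVec hdet hst.symm hb1 hbα ha1 haα hL2 ?_ ?_
    · rw [hsymm]
      ring
    · ring
end

section
/- (Uniqueness of the stationary solution in Theorem 1.) Suppose a', b' ∈ ℝ^r and real numbers λ₁, λ₁*, λ₂, λ₂* satisfy the stationarity equations (b'ᵀΣb')·Σa' − (a'ᵀΣb')·Σb' = λ₁𝟏 + λ₁*α and (a'ᵀΣa')·Σb' − (a'ᵀΣb')·Σa' = λ₂𝟏 + λ₂*α, together with the unbiasedness constraints a'ᵀ𝟏 = 1, a'ᵀα = α_s, b'ᵀ𝟏 = 1, b'ᵀα = α_t, and suppose (a'ᵀΣa')(b'ᵀΣb') − (a'ᵀΣb')² ≠ 0. Then a' = a and b' = b, the D-optimal joint BLUP coefficient vectors. -/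
open Matrix

/-- If `Sig *ᵥ x` and `Sig *ᵥ y` can be combined into two vectors of the span of `v` and `w` by a
nonsingular symmetric `2 × 2` matrix, then `x` lies in the span of `Sig⁻¹ *ᵥ v` and `Sig⁻¹ *ᵥ w`. -/
lemma exists_eq_smul_inv_mulVec_add {n : Type*} [Fintype n] [DecidableEq n]
    {Sig : Matrix n n ℝ} (hSig : IsUnit Sig.det) {v w x y : n → ℝ}
    {s t c k₁ m₁ k₂ m₂ : ℝ} (hdet : s * t - c ^ 2 ≠ 0)
    (h₁ : t • (Sig *ᵥ x) - c • (Sig *ᵥ y) = k₁ • v + m₁ • w)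
    (h₂ : s • (Sig *ᵥ y) - c • (Sig *ᵥ x) = k₂ • v + m₂ • w) :
    ∃ p q : ℝ, x = p • (Sig⁻¹ *ᵥ v) + q • (Sig⁻¹ *ᵥ w) := by
  have hx : Sig *ᵥ x = ((s * k₁ + c * k₂) / (s * t - c ^ 2)) • v +
      ((s * m₁ + c * m₂) / (s * t - c ^ 2)) • w := by
    ext i
    have e₁ := congrFun h₁ i
    have e₂ := congrFun h₂ i
    simp only [Pi.add_apply, Pi.sub_apply, Pi.smul_apply, smul_eq_mul] at e₁ e₂ ⊢
    field_simp
    linear_combination s * e₁ + c * e₂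
  refine ⟨(s * k₁ + c * k₂) / (s * t - c ^ 2), (s * m₁ + c * m₂) / (s * t - c ^ 2), ?_⟩
  rw [← mulVec_smul, ← mulVec_smul, ← mulVec_add, ← hx, mulVec_mulVec,
    nonsing_inv_mul _ hSig, one_mulVec]

lemma dotProduct_mulVec_comm_of_isSymm {n : Type*} [Fintype n] {M : Matrix n n ℝ}
    (hM : M.IsSymm) (x y : n → ℝ) : x ⬝ᵥ M *ᵥ y = y ⬝ᵥ M *ᵥ x := by
  rw [dotProduct_mulVec, ← mulVec_transpose, hM.eq, dotProduct_comm]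

/-- Cramer's rule: a vector in the span of `M *ᵥ v` and `M *ᵥ w` is determined by its dot products
with `v` and `w` when the Gram determinant does not vanish. -/
lemma eq_smul_mulVec_add_of_dotProduct_eq {n : Type*} [Fintype n]
    {M : Matrix n n ℝ} (hM : M.IsSymm) {v w x : n → ℝ} {p q d e : ℝ}
    (hx : x = p • (M *ᵥ v) + q • (M *ᵥ w)) (hv : x ⬝ᵥ v = d) (hw : x ⬝ᵥ w = e)
    (hdet : (v ⬝ᵥ M *ᵥ v) * (w ⬝ᵥ M *ᵥ w) - (v ⬝ᵥ M *ᵥ w) ^ 2 ≠ 0) :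
    x = ((v ⬝ᵥ M *ᵥ v) * (w ⬝ᵥ M *ᵥ w) - (v ⬝ᵥ M *ᵥ w) ^ 2)⁻¹ •
      (((w ⬝ᵥ M *ᵥ w) * d - (v ⬝ᵥ M *ᵥ w) * e) • (M *ᵥ v) +
        ((v ⬝ᵥ M *ᵥ v) * e - (v ⬝ᵥ M *ᵥ w) * d) • (M *ᵥ w)) := by
  have hsymm : w ⬝ᵥ M *ᵥ v = v ⬝ᵥ M *ᵥ w := dotProduct_mulVec_comm_of_isSymm hM w v
  rw [hx, dotProduct_comm, dotProduct_add, dotProduct_smul, dotProduct_smul] at hv hw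
  rw [hsymm] at hw
  simp only [smul_eq_mul] at hv hw
  ext i
  rw [hx]
  simp only [Pi.add_apply, Pi.smul_apply, smul_eq_mul]
  rw [← hv, ← hw, eq_inv_mul_iff_mul_eq₀ hdet]
  ring

/-- Uniqueness of the stationary solution in Theorem 1: any pair `a', b'` satisfying
the Lagrange stationarity equations and the unbiasedness constraints, with
nonsingular variance–covariance matrix, coincides with the D-optimal joint BLUP
coefficient vectors `a` and `b`. -/
theorem d_optimal_blup_uniqueness
    {r : ℕ} (hr : 0 < r)
    (Sig : Matrix (Fin r) (Fin r) ℝ) (hSig : Sig.PosDef)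
    (one : Fin r → ℝ) (hone : one = fun _ => (1 : ℝ))
    (α : Fin r → ℝ) (αs αt : ℝ) (hst : αs ≠ αt)
    (ip : (Fin r → ℝ) → (Fin r → ℝ) → ℝ)
    (hip : ∀ x y, ip x y = x ⬝ᵥ (Sig⁻¹ *ᵥ y))
    (Δ : ℝ) (hΔ : Δ = ip one one * ip α α - (ip one α) ^ 2) (hΔ0 : Δ ≠ 0)
    (αS αT : Fin r → ℝ) (hαS : αS = α - αs • one) (hαT : αT = α - αt • one)
    (a b : Fin r → ℝ)
    (ha : a = ((αt - αs) * Δ)⁻¹ •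
      (ip αS αT • (Sig⁻¹ *ᵥ αS) - ip αS αS • (Sig⁻¹ *ᵥ αT)))
    (hb : b = ((αt - αs) * Δ)⁻¹ •
      (ip αT αT • (Sig⁻¹ *ᵥ αS) - ip αT αS • (Sig⁻¹ *ᵥ αT)))
    (a' b' : Fin r → ℝ) (l1 l1s l2 l2s : ℝ)
    (hL1 : (b' ⬝ᵥ (Sig *ᵥ b')) • (Sig *ᵥ a') - (a' ⬝ᵥ (Sig *ᵥ b')) • (Sig *ᵥ b') =
      l1 • one + l1s • α)
    (hL2 : (a' ⬝ᵥ (Sig *ᵥ a')) • (Sig *ᵥ b') - (a' ⬝ᵥ (Sig *ᵥ b')) • (Sig *ᵥ a') =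
      l2 • one + l2s • α)
    (ha'1 : a' ⬝ᵥ one = 1) (ha'α : a' ⬝ᵥ α = αs)
    (hb'1 : b' ⬝ᵥ one = 1) (hb'α : b' ⬝ᵥ α = αt)
    (hVne : (a' ⬝ᵥ (Sig *ᵥ a')) * (b' ⬝ᵥ (Sig *ᵥ b')) - (a' ⬝ᵥ (Sig *ᵥ b')) ^ 2 ≠ 0) :
    a' = a ∧ b' = b := by
  have hU : IsUnit Sig.det := hSig.det_pos.ne'.isUnit
  have hS : Sig⁻¹.IsSymm := by
    have h : Sig⁻¹ᴴ = Sig⁻¹ := hSig.isHermitian.inv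
    rwa [conjTranspose_eq_transpose_of_trivial] at h
  simp only [hip] at hΔ ha hb
  obtain ⟨p, q, hpq⟩ := exists_eq_smul_inv_mulVec_add hU hVne hL1 hL2
  obtain ⟨p', q', hpq'⟩ :=
    exists_eq_smul_inv_mulVec_add hU (by rwa [mul_comm]) hL2 hL1
  have ea := eq_smul_mulVec_add_of_dotProduct_eq hS hpq ha'1 ha'α (hΔ ▸ hΔ0)
  have eb := eq_smul_mulVec_add_of_dotProduct_eq hS hpq' hb'1 hb'α (hΔ ▸ hΔ0)
  rw [← hΔ] at ea eb
  have hsymm := dotProduct_mulVec_comm_of_isSymm hS α one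
  have hne : αt - αs ≠ 0 := sub_ne_zero.mpr hst.symm
  rw [ea, eb, ha, hb, hαS, hαT]
  simp only [mulVec_sub, mulVec_smul, dotProduct_sub, sub_dotProduct, dotProduct_smul,
    smul_dotProduct, smul_eq_mul, hsymm]
  constructor <;>
  · ext i
    simp only [Pi.add_apply, Pi.sub_apply, Pi.smul_apply, smul_eq_mul]
    field_simp
    ring
end

section
/- For any real numbers A₁, A₂, A₃, B₁, B₂, B₃, the 6×6 real matrix with rows (A₁, A₂, A₃, 0, 0, 0), (B₁, B₂, B₃, 0, 0, 0), (0, A₁, 0, A₂, A₃, 0), (0, B₁, 0, B₂, B₃, 0), (0, 0, A₁, 0, A₂, A₃), (0, 0, B₁, 0, B₂, B₃) has determinant zero. -/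
open Matrix

/-- The coefficient matrix of the linear system (LE) for three joint predictors is
singular: for any real numbers `A₁, A₂, A₃, B₁, B₂, B₃`, the 6×6 matrix with rows
`(A₁, A₂, A₃, 0, 0, 0)`, `(B₁, B₂, B₃, 0, 0, 0)`, `(0, A₁, 0, A₂, A₃, 0)`,
`(0, B₁, 0, B₂, B₃, 0)`, `(0, 0, A₁, 0, A₂, A₃)`, `(0, 0, B₁, 0, B₂, B₃)` has
determinant zero.  This establishes the non-existence of joint BLUPs of three or
more order statistics in the location-scale family. -/
theorem joint_blup_three_order_statistics_coefficient_matrix_singular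
    (A1 A2 A3 B1 B2 B3 : ℝ) :
    (!![A1, A2, A3, 0, 0, 0;
        B1, B2, B3, 0, 0, 0;
        0, A1, 0, A2, A3, 0;
        0, B1, 0, B2, B3, 0;
        0, 0, A1, 0, A2, A3;
        0, 0, B1, 0, B2, B3] : Matrix (Fin 6) (Fin 6) ℝ).det = 0 := by
  by_cases hw : ![B1, -A1, B2, -A2, B3, -A3] = 0
  · simp only [cons_eq_zero_iff, neg_eq_zero] at hw
    obtain ⟨rfl, rfl, rfl, rfl, rfl, rfl, -⟩ := hw
    exact det_eq_zero_of_row_eq_zero 0 fun j => by fin_cases j <;> rfl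
  · -- The relation between the rows is `Bᵀ V A = Aᵀ V B` for symmetric `V`.
    refine exists_vecMul_eq_zero_iff.mp ⟨_, hw, ?_⟩
    ext j
    fin_cases j <;> simp [vecMul, dotProduct, Fin.sum_univ_succ] <;> ring
end

section
/- (Non-existence of joint BLUPs in the scale family.) Suppose there exist real numbers λ₁ and λ₂ such that λ₁·α = (bᵀΣb)·Σa − (aᵀΣb)·Σb and λ₂·α = (aᵀΣa)·Σb − (aᵀΣb)·Σa, and suppose aᵀα ≠ 0 and bᵀα ≠ 0. Then (aᵀΣa)(bᵀΣb) = (aᵀΣb)², i.e. the variance–covariance matrix of the joint predictors is singular, and the vectors a and b are linearly dependent. -/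
open Matrix

/-- Non-existence of joint BLUPs in the scale family: if the Lagrange stationarity
equations `λ₁·α = (bᵀΣb)·Σa − (aᵀΣb)·Σb` and `λ₂·α = (aᵀΣa)·Σb − (aᵀΣb)·Σa` hold
for some real `λ₁, λ₂`, and `aᵀα ≠ 0` and `bᵀα ≠ 0`, then
`(aᵀΣa)(bᵀΣb) = (aᵀΣb)²` — the variance–covariance matrix of the joint predictors
is singular — and the vectors `a` and `b` are linearly dependent. -/
theorem scale_family_joint_blup_nonexistence
    {r : ℕ} (hr : 0 < r)
    (Sig : Matrix (Fin r) (Fin r) ℝ) (hSig : Sig.PosDef)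
    (α : Fin r → ℝ) (a b : Fin r → ℝ)
    (l1 l2 : ℝ)
    (hL1 : l1 • α = (b ⬝ᵥ (Sig *ᵥ b)) • (Sig *ᵥ a) - (a ⬝ᵥ (Sig *ᵥ b)) • (Sig *ᵥ b))
    (hL2 : l2 • α = (a ⬝ᵥ (Sig *ᵥ a)) • (Sig *ᵥ b) - (a ⬝ᵥ (Sig *ᵥ b)) • (Sig *ᵥ a))
    (haα : a ⬝ᵥ α ≠ 0) (hbα : b ⬝ᵥ α ≠ 0) :
    (a ⬝ᵥ (Sig *ᵥ a)) * (b ⬝ᵥ (Sig *ᵥ b)) = (a ⬝ᵥ (Sig *ᵥ b)) ^ 2 ∧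
    ¬ LinearIndependent ℝ ![a, b] := by
  have hsymm : b ⬝ᵥ (Sig *ᵥ a) = a ⬝ᵥ (Sig *ᵥ b) := by
    have hT : Sigᵀ = Sig := by simpa [Matrix.IsHermitian] using hSig.isHermitian
    rw [dotProduct_mulVec, ← mulVec_transpose, hT, dotProduct_comm]
  have hl1 : l1 = 0 := by
    have h := congrArg (b ⬝ᵥ ·) hL1
    simp only [dotProduct_smul, dotProduct_sub, smul_eq_mul, hsymm] at h
    exact (mul_eq_zero.mp (h.trans (by ring))).resolve_right hbα
  rw [hl1, zero_smul] at hL1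
  refine ⟨?_, fun hli => ?_⟩
  · have h := congrArg (a ⬝ᵥ ·) hL1
    simp only [dotProduct_smul, dotProduct_sub, smul_eq_mul, dotProduct_zero] at h
    linarith
  · have hb : b ≠ 0 := by
      rintro rfl
      simp at hbα
    have hbb : 0 < b ⬝ᵥ (Sig *ᵥ b) := by simpa using hSig.dotProduct_mulVec_pos hb
    have hcomb : (b ⬝ᵥ (Sig *ᵥ b)) • a + (-(a ⬝ᵥ (Sig *ᵥ b))) • b = 0 := by
      by_contra hv
      have hpos := hSig.dotProduct_mulVec_pos hv
      rw [mulVec_add, mulVec_smul, mulVec_smul, neg_smul _ (Sig *ᵥ b), ← sub_eq_add_neg,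
        ← hL1, dotProduct_zero] at hpos
      exact lt_irrefl _ hpos
    exact hbb.ne' (LinearIndependent.pair_iff.mp hli _ _ hcomb).1
end
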